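/- arXiv:1209.0523 — 5 statements merged into one kernel-verified Lean document; each statement's English description precedes it below -/
import Mathlib

section
/- Let P, Q ∈ ℂ^{n×n} be orthogonal projectors (Pᴴ = P, P² = P, Qᴴ = Q, Q² = Q). Let B be the Moore–Penrose pseudoinverse of PQ and set T = (I − P) B. Then for every real number t > 0, the dimension of the kernel of TᴴT − t²·I equals the dimension of the kernel of PQP − (1+t²)⁻¹·I. In other words, the positive singular values of T = P_{X⊥}(P_X P_Y)† are exactly the tangents of the principal angles in (0, π/2) between the ranges of P and Q, counted with multiplicity. -/
open scoped Matrix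

/-- `B` is the Moore–Penrose pseudoinverse of `A`. -/
def IsMoorePenrose {n : ℕ} (A B : Matrix (Fin n) (Fin n) ℂ) : Prop :=
  A * B * A = A ∧ B * A * B = B ∧ (A * B)ᴴ = A * B ∧ (B * A)ᴴ = B * A

theorem tan_theta_projectors
    (n : ℕ) (P Q : Matrix (Fin n) (Fin n) ℂ)
    (hP : Pᴴ = P) (hP2 : P * P = P) (hQ : Qᴴ = Q) (hQ2 : Q * Q = Q)
    (B : Matrix (Fin n) (Fin n) ℂ) (hB : IsMoorePenrose (P * Q) B)
    (T : Matrix (Fin n) (Fin n) ℂ) (hT : T = (1 - P) * B) :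
    ∀ t : ℝ, 0 < t →
      Module.finrank ℂ (LinearMap.ker (Tᴴ * T - ((t : ℂ) ^ 2) • 1).mulVecLin)
        = Module.finrank ℂ
            (LinearMap.ker (P * Q * P - (1 + (t : ℂ) ^ 2)⁻¹ • 1).mulVecLin) := by
  intro t ht
  obtain ⟨h1, h2, h3, h4⟩ := hB
  have hne : (1 + (t : ℂ) ^ 2) ≠ 0 := by
    have : (1 + t ^ 2 : ℝ) ≠ 0 := by positivity
    exact_mod_cast this
  have ht2 : ((t : ℂ) ^ 2) ≠ 0 := by
    have : (t ^ 2 : ℝ) ≠ 0 := by positivity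
    exact_mod_cast this
  have hAH : (P * Q)ᴴ = Q * P := by rw [Matrix.conjTranspose_mul, hP, hQ]
  have hBA : Q * P * Bᴴ = B * (P * Q) := by
    rw [← hAH, ← Matrix.conjTranspose_mul, h4]
  have hAB : Bᴴ * (Q * P) = P * Q * B := by
    rw [← hAH, ← Matrix.conjTranspose_mul, h3]
  have hQB : Q * B = B := by
    have e : B = Q * P * Bᴴ * B := by rw [hBA, h2]
    calc Q * B = Q * (Q * P * Bᴴ * B) := by rw [← e]
      _ = (Q * Q) * P * Bᴴ * B := by simp only [Matrix.mul_assoc]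
      _ = B := by rw [hQ2, ← e]
  obtain ⟨E, hE⟩ : ∃ E, E = P * Q * B := ⟨_, rfl⟩
  obtain ⟨N, hN⟩ : ∃ N, N = Bᴴ * B := ⟨_, rfl⟩
  obtain ⟨M, hM⟩ : ∃ M, M = P * Q * P := ⟨_, rfl⟩
  have hPB : P * B = E := by rw [hE, Matrix.mul_assoc, hQB]
  have hEH : Eᴴ = E := by rw [hE, h3]
  have hBE : B * E = B := by rw [hE, ← Matrix.mul_assoc, h2]
  have hNE : N * E = N := by rw [hN, Matrix.mul_assoc, hBE]
  have hNH : Nᴴ = N := by rw [hN, Matrix.conjTranspose_mul, Matrix.conjTranspose_conjTranspose]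
  have hMH : Mᴴ = M := by
    rw [hM, Matrix.conjTranspose_mul, hAH, hP, Matrix.mul_assoc]
  have hEN : E * N = N := by
    have := congrArg Matrix.conjTranspose hNE
    rwa [Matrix.conjTranspose_mul, hEH, hNH] at this
  have hEE : E * E = E := by
    nth_rewrite 1 [← hPB]
    rw [Matrix.mul_assoc, hBE, hPB]
  have hM' : M = P * Q * (Q * P) := by
    rw [hM, Matrix.mul_assoc P Q (Q * P), ← Matrix.mul_assoc Q Q P, hQ2, Matrix.mul_assoc]
  have hEM : E * M = M := by
    rw [hM', hE, ← Matrix.mul_assoc, h1]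
  have hMN : M * N = E := by
    calc M * N = P * Q * (Q * P * Bᴴ) * B := by rw [hM', hN]; simp only [Matrix.mul_assoc]
      _ = P * Q * (B * (P * Q) * B) := by rw [hBA]; simp only [Matrix.mul_assoc]
      _ = E := by rw [h2, hE]
  have hNM : N * M = E := by
    have := congrArg Matrix.conjTranspose hMN
    rwa [Matrix.conjTranspose_mul, hEH, hNH, hMH] at this
  have hTT : Tᴴ * T = N - E := by
    have e : T = B - E := by rw [hT, Matrix.sub_mul, Matrix.one_mul, hPB]
    have hBHE : Bᴴ * E = E := by
      have : Bᴴ * P = E := by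
        have := congrArg Matrix.conjTranspose hPB
        rwa [Matrix.conjTranspose_mul, hEH, hP] at this
      calc Bᴴ * E = Bᴴ * (P * P * B) := by rw [hP2, hPB]
        _ = (Bᴴ * P) * (P * B) := by simp only [Matrix.mul_assoc]
        _ = E := by rw [this, hPB, hEE]
    have hEB : E * B = E := by
      have := congrArg Matrix.conjTranspose hBHE
      rwa [Matrix.conjTranspose_mul, hEH, Matrix.conjTranspose_conjTranspose] at this
    rw [e, Matrix.conjTranspose_sub, hEH, Matrix.sub_mul, Matrix.mul_sub, Matrix.mul_sub,
      hBHE, hEB, hEE, ← hN, sub_self, sub_zero]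
  rw [hTT, ← hM]
  have key : LinearMap.ker (N - E - ((t : ℂ) ^ 2) • 1).mulVecLin
      = LinearMap.ker (M - (1 + (t : ℂ) ^ 2)⁻¹ • 1).mulVecLin := by
    ext v
    simp only [LinearMap.mem_ker, Matrix.mulVecLin_apply, Matrix.sub_mulVec, Matrix.smul_mulVec,
      Matrix.one_mulVec, sub_eq_zero]
    constructor
    · intro h
      have h' := congrArg (fun w => E *ᵥ w) h
      simp only [Matrix.mulVec_sub, Matrix.mulVec_smul, Matrix.mulVec_mulVec, hEN, hEE] at h'
      have hv : E *ᵥ v = v := (smul_right_injective _ ht2 (h.symm.trans h')).symm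
      have hNv : N *ᵥ v = (1 + (t : ℂ) ^ 2) • v := by
        rw [hv, sub_eq_iff_eq_add] at h
        rw [h, add_smul, one_smul, add_comm]
      have h5 := congrArg (fun w => M *ᵥ w) hNv
      simp only [Matrix.mulVec_smul, Matrix.mulVec_mulVec, hMN, hv] at h5
      rw [eq_inv_smul_iff₀ hne, ← h5]
    · intro h
      have h' := congrArg (fun w => E *ᵥ w) h
      simp only [Matrix.mulVec_smul, Matrix.mulVec_mulVec, hEM] at h'
      have hv : E *ᵥ v = v :=
        (smul_right_injective _ (inv_ne_zero hne) (h.symm.trans h')).symm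
      have h5 := congrArg (fun w => N *ᵥ w) h
      simp only [Matrix.mulVec_smul, Matrix.mulVec_mulVec, hNM, hv] at h5
      rw [eq_inv_smul_iff₀ hne] at h5
      rw [hv, ← h5, add_smul, one_smul, add_sub_cancel_left]
  rw [key]
end

section
/- Let P, Q ∈ ℂ^{n×n} be orthogonal projectors (Pᴴ = P, P² = P, Qᴴ = Q, Q² = Q), and let B be the Moore–Penrose pseudoinverse of PQ. Then Q B = B, B P = B, and B·B = B; that is, (P_X P_Y)† is an idempotent whose range lies in the range of Q and which acts through P on the left. -/
open scoped Matrix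

theorem pinv_of_projector_product_is_idempotent
    (n : ℕ) (P Q : Matrix (Fin n) (Fin n) ℂ)
    (hP : Pᴴ = P) (hP2 : P * P = P) (hQ : Qᴴ = Q) (hQ2 : Q * Q = Q)
    (B : Matrix (Fin n) (Fin n) ℂ) (hB : IsMoorePenrose (P * Q) B) :
    Q * B = B ∧ B * P = B ∧ B * B = B := by
  obtain ⟨_, h2, h3, h4⟩ := hB
  have e1 : Q * (B * (P * Q)) = B * (P * Q) := by
    rw [← h4]
    simp only [Matrix.conjTranspose_mul, hP, hQ]
    simp only [← Matrix.mul_assoc, hQ2]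
  have e2 : (P * Q * B) * P = P * Q * B := by
    rw [← h3]
    simp only [Matrix.conjTranspose_mul, hP, hQ]
    simp only [Matrix.mul_assoc, hP2]
  have hQB : Q * B = B := by
    calc Q * B = Q * (B * (P * Q) * B) := by rw [h2]
      _ = Q * (B * (P * Q)) * B := by simp only [Matrix.mul_assoc]
      _ = B := by rw [e1, h2]
  have hBP : B * P = B := by
    calc B * P = B * (P * Q) * B * P := by rw [h2]
      _ = B * (P * Q * B * P) := by simp only [Matrix.mul_assoc]
      _ = B * (P * Q) * B := by rw [e2]; simp only [Matrix.mul_assoc]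
      _ = B := h2
  refine ⟨hQB, hBP, ?_⟩
  calc B * B = (B * P) * (Q * B) := by rw [hQB, hBP]
    _ = B * (P * Q) * B := by simp only [Matrix.mul_assoc]
    _ = B := h2
end

section
/- Let P, Q ∈ ℂ^{n×n} be orthogonal projectors (Pᴴ = P, P² = P, Qᴴ = Q, Q² = Q), and let B be the Moore–Penrose pseudoinverse of PQ. If the column space of PQ equals the column space of P (equivalently, ran(P) ∩ ran(Q)ᗮ = {0}, which holds when all principal angles between ran(P) and ran(Q) are less than π/2 and dim ran(P) ≤ dim ran(Q)), then P B = P, and consequently (I − P) B = B − P. -/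
open scoped Matrix

theorem P_mul_pinv_eq_P
    (n : ℕ) (P Q : Matrix (Fin n) (Fin n) ℂ)
    (hP : Pᴴ = P) (hP2 : P * P = P) (hQ : Qᴴ = Q) (hQ2 : Q * Q = Q)
    (B : Matrix (Fin n) (Fin n) ℂ) (hB : IsMoorePenrose (P * Q) B)
    (hrange : LinearMap.range (P * Q).mulVecLin = LinearMap.range P.mulVecLin) :
    P * B = P ∧ (1 - P) * B = B - P := by
  obtain ⟨h1, h2, h3, h4⟩ := hB
  -- `Q * B = B`, since the range of `B` lies in the range of `(P * Q)ᴴ = Q * P`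
  have hQBA : Q * (B * (P * Q)) = B * (P * Q) := by
    rw [← h4]
    simp only [Matrix.conjTranspose_mul, hP, hQ, ← Matrix.mul_assoc, hQ2]
  have hQB : Q * B = B := by
    calc Q * B = Q * (B * (P * Q)) * B := by
          rw [Matrix.mul_assoc Q, h2]
      _ = B := by rw [hQBA, h2]
  -- `P * Q * B` fixes the range of `P`
  have hfix : P * Q * B * P = P := by
    apply Matrix.ext_of_mulVec_single
    intro i
    have hm : P *ᵥ Pi.single i 1 ∈ LinearMap.range (P * Q).mulVecLin := by
      rw [hrange]
      exact ⟨Pi.single i 1, rfl⟩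
    obtain ⟨x, hx⟩ := hm
    rw [Matrix.mulVecLin_apply] at hx
    rw [← Matrix.mulVec_mulVec, ← hx, Matrix.mulVec_mulVec, h1]
  have hPB : P * B = P := by
    have h5 := congrArg Matrix.conjTranspose hfix
    rw [Matrix.conjTranspose_mul, h3, hP, Matrix.mul_assoc P Q B, hQB,
      ← Matrix.mul_assoc, hP2] at h5
    exact h5
  exact ⟨hPB, by rw [Matrix.sub_mul, Matrix.one_mul, hPB]⟩
end

section
/- Let P, Q ∈ ℂ^{n×n} be orthogonal projectors (Pᴴ = P, P² = P, Qᴴ = Q, Q² = Q), and let B be the Moore–Penrose pseudoinverse of PQ. If the column space of (PQ)ᴴ = QP equals the column space of Q (equivalently, ran(Q) ∩ ran(P)ᗮ = {0}, which holds when all principal angles between ran(P) and ran(Q) are less than π/2 and dim ran(Q) ≤ dim ran(P)), then B Q = Q, and consequently B (I − Q) = B − Q. -/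
open scoped Matrix

theorem pinv_mul_Q_eq_Q
    (n : ℕ) (P Q : Matrix (Fin n) (Fin n) ℂ)
    (hP : Pᴴ = P) (hP2 : P * P = P) (hQ : Qᴴ = Q) (hQ2 : Q * Q = Q)
    (B : Matrix (Fin n) (Fin n) ℂ) (hB : IsMoorePenrose (P * Q) B)
    (hrange : LinearMap.range (Q * P).mulVecLin = LinearMap.range Q.mulVecLin) :
    B * Q = Q ∧ B * (1 - Q) = B - Q := by
  obtain ⟨h1, h2, h3, h4⟩ := hB
  have hA : (P * Q)ᴴ = Q * P := by rw [Matrix.conjTranspose_mul, hP, hQ]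
  have hAB : P * Q * B = Bᴴ * (Q * P) := by
    rw [← hA, ← Matrix.conjTranspose_mul, h3]
  have hBP : B * P = B := by
    have h5 : B = B * (Bᴴ * (Q * P)) := by
      rw [← hAB, ← Matrix.mul_assoc, h2]
    calc B * P = B * (Bᴴ * (Q * P)) * P := by rw [← h5]
      _ = B * (Bᴴ * (Q * (P * P))) := by simp only [Matrix.mul_assoc]
      _ = B := by rw [hP2, ← h5]
  have hBQ : B * Q = B * (P * Q) := by rw [← Matrix.mul_assoc, hBP]
  have hfix : B * (P * Q) * (Q * P) = Q * P := by
    rw [← h4, ← hA, ← Matrix.conjTranspose_mul, ← Matrix.mul_assoc, h1]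
  have hfixQ : B * (P * Q) * Q = Q := by
    refine Matrix.mulVec_injective (funext fun v => ?_)
    have hv : Q.mulVecLin v ∈ LinearMap.range (Q * P).mulVecLin := by
      rw [hrange]; exact ⟨v, rfl⟩
    obtain ⟨w, hw⟩ := hv
    simp only [Matrix.mulVecLin_apply] at hw
    rw [← Matrix.mulVec_mulVec, ← hw, Matrix.mulVec_mulVec, hfix]
  have hmain : B * Q = Q := by
    calc B * Q = B * (P * Q) := hBQ
      _ = B * (P * (Q * Q)) := by rw [hQ2]
      _ = B * (P * Q) * Q := by simp only [Matrix.mul_assoc]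
      _ = Q := hfixQ
  exact ⟨hmain, by rw [Matrix.mul_sub, Matrix.mul_one, hmain]⟩
end

section
/- Let P, Q ∈ ℂ^{n×n} be orthogonal projectors (Pᴴ = P, P² = P, Qᴴ = Q, Q² = Q). Let B be the Moore–Penrose pseudoinverse of PQ and C the Moore–Penrose pseudoinverse of (I − P)(I − Q). Then −((I − P) B)ᴴ = P C, and moreover P C = P (I − Q) C = ((I − Q) − (I − P)) C; that is, −(P_{X⊥}(P_X P_Y)†)ᴴ = P_X (P_{X⊥} P_{Y⊥})† = P_X P_{Y⊥} (P_{X⊥} P_{Y⊥})† = (P_{Y⊥} − P_{X⊥})(P_{X⊥} P_{Y⊥})†. -/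
open scoped Matrix

theorem conj_transpose_relation_complements
    (n : ℕ) (P Q : Matrix (Fin n) (Fin n) ℂ)
    (hP : Pᴴ = P) (hP2 : P * P = P) (hQ : Qᴴ = Q) (hQ2 : Q * Q = Q)
    (B : Matrix (Fin n) (Fin n) ℂ) (hB : IsMoorePenrose (P * Q) B)
    (C : Matrix (Fin n) (Fin n) ℂ) (hC : IsMoorePenrose ((1 - P) * (1 - Q)) C) :
    -(((1 - P) * B)ᴴ) = P * C ∧
    P * C = P * (1 - Q) * C ∧
    P * C = ((1 - Q) - (1 - P)) * C := by
  obtain ⟨b1, b2, b3, b4⟩ := hB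
  obtain ⟨c1, c2, c3, c4⟩ := hC
  have hR : (1 - P)ᴴ = 1 - P := by simp [hP]
  have hS : (1 - Q)ᴴ = 1 - Q := by simp [hQ]
  have hR2 : (1 - P) * (1 - P) = 1 - P := by rw [mul_sub, sub_mul, sub_mul, hP2]; simp
  have hPR : P * (1 - P) = 0 := by rw [mul_sub, hP2]; simp
  have hQS : Q * (1 - Q) = 0 := by rw [mul_sub, hQ2]; simp
  have hAH : (P * Q)ᴴ = Q * P := by rw [Matrix.conjTranspose_mul, hP, hQ]
  have hMH : ((1 - P) * (1 - Q))ᴴ = (1 - Q) * (1 - P) := by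
    rw [Matrix.conjTranspose_mul, hR, hS]
  have hBe : B = Q * P * Bᴴ * B := by
    rw [← hAH, ← Matrix.conjTranspose_mul, b4, b2]
  have hD : Bᴴ = Bᴴ * B * P * Q := by
    have h := congrArg Matrix.conjTranspose hBe
    simpa [Matrix.conjTranspose_mul, hP, hQ, Matrix.mul_assoc] using h
  have hCe : C = (1 - Q) * (1 - P) * Cᴴ * C := by
    rw [← hMH, ← Matrix.conjTranspose_mul, c4, c2]
  have hDQ : Bᴴ * Q = Bᴴ := by
    rw [hD, Matrix.mul_assoc _ Q Q, hQ2]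
  have hQC : Q * C = 0 := by
    rw [hCe]; simp only [← Matrix.mul_assoc]; rw [hQS]; simp
  have hDA : Bᴴ * (P * Q) = P * Q := by
    have h : Bᴴ * (Q * P) * (P * Q) = P * Q := by
      rw [← hAH, ← Matrix.conjTranspose_mul, b3, b1]
    calc Bᴴ * (P * Q) = (Bᴴ * Q) * (P * Q) := by rw [hDQ]
      _ = (Bᴴ * Q) * ((P * P) * Q) := by rw [hP2]
      _ = Bᴴ * (Q * P) * (P * Q) := by simp only [Matrix.mul_assoc]
      _ = P * Q := h
  have hPSR : P * (1 - Q) * (1 - P) = -(P * Q * (1 - P)) := by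
    rw [mul_sub P 1 Q, sub_mul, mul_one, hPR, zero_sub]
  have hPC : P * C = -(P * Q * (1 - P)) * (Cᴴ * C) := by
    rw [← hPSR]
    conv_lhs => rw [hCe]
    simp only [Matrix.mul_assoc]
  have hDPC : Bᴴ * (P * C) = P * C := by
    rw [hPC, ← Matrix.mul_assoc Bᴴ, Matrix.mul_neg, ← Matrix.mul_assoc Bᴴ, hDA]
  have hDC : Bᴴ * C = 0 := by rw [← hDQ, Matrix.mul_assoc, hQC, Matrix.mul_zero]
  have hSC : (1 - Q) * C = C := by rw [sub_mul, hQC]; simp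
  have hMC : (1 - P) * (1 - Q) * C = (1 - P) * C := by rw [Matrix.mul_assoc, hSC]
  -- W is the projector onto the intersection of X-perp and Y
  obtain ⟨W, hW⟩ : ∃ W, W = (1 - P) - (1 - P) * C := ⟨_, rfl⟩
  have hPW : P * W = 0 := by
    rw [hW, mul_sub, ← Matrix.mul_assoc, hPR]; simp
  have hSW : (1 - Q) * W = 0 := by
    have h : (1 - Q) * (1 - P) * ((1 - P) * C) = (1 - Q) * (1 - P) := by
      have h := congrArg Matrix.conjTranspose c1
      rw [Matrix.conjTranspose_mul, c3, hMH, hMC] at h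
      exact h
    rw [Matrix.mul_assoc, ← Matrix.mul_assoc (1 - P), hR2] at h
    rw [hW, mul_sub, h, sub_self]
  have hQW : Q * W = W := by
    rw [sub_mul, one_mul, sub_eq_zero] at hSW
    exact hSW.symm
  have hDW : Bᴴ * W = 0 := by
    rw [hD, Matrix.mul_assoc, hQW, Matrix.mul_assoc, hPW, Matrix.mul_zero]
  refine ⟨?_, ?_, ?_⟩
  · rw [Matrix.conjTranspose_mul, hR]
    rw [hW, mul_sub, sub_eq_zero] at hDW
    rw [hDW, sub_mul, mul_sub, hDPC, one_mul, hDC]; simp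
  · rw [Matrix.mul_assoc, hSC]
  · rw [sub_mul, hSC, sub_mul, one_mul]; simp
end
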